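/- arXiv:1609.02250 — 3 statements merged into one kernel-verified Lean document; each statement's English description precedes it below -/
import Mathlib

section
/- The classes in (QP_5)_9 of the fifteen monomials x_1x_2x_3^2x_4^2x_5^3, x_1x_2x_3^2x_4^3x_5^2, x_1x_2x_3^3x_4^2x_5^2, x_1x_2^2x_3x_4^2x_5^3, x_1x_2^2x_3x_4^3x_5^2, x_1x_2^2x_3^2x_4x_5^3, x_1x_2^2x_3^2x_4^3x_5, x_1x_2^2x_3^3x_4x_5^2, x_1x_2^2x_3^3x_4^2x_5, x_1x_2^3x_3x_4^2x_5^2, x_1x_2^3x_3^2x_4x_5^2, x_1x_2^3x_3^2x_4^2x_5, x_1^3x_2x_3x_4^2x_5^2, x_1^3x_2x_3^2x_4x_5^2, x_1^3x_2x_3^2x_4^2x_5 are linearly independent over F_2; that is, no nonzero F_2-linear combination of these fifteen monomials is hit. -/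
open MvPolynomial

noncomputable section

/-- The polynomial algebra `P_5 = F_2[x_1,...,x_5]`. -/
abbrev P5 : Type := MvPolynomial (Fin 5) (ZMod 2)

/-- The total Steenrod square: the `F_2`-algebra endomorphism with `Sq (x_i) = x_i + x_i ^ 2`. -/
def Sq : P5 →ₐ[ZMod 2] P5 := aeval fun i => X i + X i ^ 2

/-- `f` (homogeneous of degree `n`) is hit if it is the degree-`n` homogeneous component of
`Sq g` for some `g` all of whose homogeneous components have degree `< n`. -/
def IsHit (n : ℕ) (f : P5) : Prop :=
  ∃ g : P5, (∀ m, n ≤ m → homogeneousComponent m g = 0) ∧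
    f = homogeneousComponent n (Sq g)

/-- The subspace of hit polynomials of degree `n`. -/
def hitSpan (n : ℕ) : Submodule (ZMod 2) P5 :=
  Submodule.span (ZMod 2) {f : P5 | IsHit n f}

/-- The action of `GL_5(F_2)` on `P_5` by linear substitution of the variables. -/
def actGL (g : Matrix.GeneralLinearGroup (Fin 5) (ZMod 2)) : P5 →ₐ[ZMod 2] P5 :=
  aeval fun i => ∑ j, ((g : Matrix (Fin 5) (Fin 5) (ZMod 2)) i j) • X j

/-- `wt d i` is the `(i+1)`-st entry `ω_{i+1}` of the weight vector of the monomial with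
exponent vector `d`, i.e. the number of `j` such that bit `i` of `d j` is `1`. -/
def wt (d : Fin 5 →₀ ℕ) (i : ℕ) : ℕ :=
  (Finset.univ.filter fun j : Fin 5 => Nat.testBit (d j) i).card

/-- The weight vector of the exponent vector `d` equals the (finitely supported) list `w`. -/
def hasWt (d : Fin 5 →₀ ℕ) (w : List ℕ) : Prop :=
  ∀ i, wt d i = w.getD i 0

/-- The weight vector of `d` is strictly smaller than `w` in left lexicographic order. -/
def wtLt (d : Fin 5 →₀ ℕ) (w : List ℕ) : Prop :=
  ∃ i, (∀ j, j < i → wt d j = w.getD j 0) ∧ wt d i < w.getD i 0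

/-- `P_5^-(ω)`: the span of degree-`n` monomials whose weight vector is `< w`. -/
def PMinus (n : ℕ) (w : List ℕ) : Submodule (ZMod 2) P5 :=
  Submodule.span (ZMod 2)
    {x : P5 | ∃ d : Fin 5 →₀ ℕ, x = monomial d 1 ∧ (∑ j, d j) = n ∧ wtLt d w}

/-- `P_5(ω)`: the span of degree-`n` monomials whose weight vector is `≤ w`. -/
def PLe (n : ℕ) (w : List ℕ) : Submodule (ZMod 2) P5 :=
  Submodule.span (ZMod 2)
    {x : P5 | ∃ d : Fin 5 →₀ ℕ, x = monomial d 1 ∧ (∑ j, d j) = n ∧ (wtLt d w ∨ hasWt d w)}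

/-- The monomial `x_1^a x_2^b x_3^c x_4^d x_5^e`. -/
def mon (a b c d e : ℕ) : P5 :=
  X 0 ^ a * X 1 ^ b * X 2 ^ c * X 3 ^ d * X 4 ^ e

/-- Lucas: `d.choose j` is even whenever `d + j = 2 ^ m - 1` and `j ≠ 0`. -/
lemma even_choose_of_add_add_one_eq_two_pow {m d j : ℕ} (h : d + j + 1 = 2 ^ m) (hj : j ≠ 0) :
    Even (d.choose j) := by
  induction m generalizing d j with
  | zero => omega
  | succ m ih =>
    have key : d.choose j ≡ (d % 2).choose (j % 2) * (d / 2).choose (j / 2) [MOD 2] :=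
      Choose.choose_modEq_choose_mod_mul_choose_div_nat
    rw [pow_succ] at h
    rw [Nat.even_iff, key]
    rcases Nat.mod_two_eq_zero_or_one d with hd | hd
    · have hj' : j % 2 = 1 := by omega
      simp [hd, hj']
    · have ih' : Even ((d / 2).choose (j / 2)) := ih (by omega) (by omega)
      rw [← Nat.even_iff]
      exact ih'.mul_left _

/-- The total square of a monomial never involves a spike other than the monomial itself. -/
lemma coeff_Sq_monomial_of_spike {s d : Fin 5 →₀ ℕ} (hs : ∀ i, ∃ m, s i + 1 = 2 ^ m)
    (hd : d ≠ s) (a : ZMod 2) : coeff s (Sq (monomial d a)) = 0 := by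
  have hfactor (i : Fin 5) : (X i + X i ^ 2 : P5) ^ d i =
      ∑ k ∈ Finset.range (d i + 1), C ((d i).choose k : ZMod 2) * X i ^ (d i + k) := by
    rw [show (X i + X i ^ 2 : P5) = X i * (X i + 1) by ring, mul_pow, add_pow, Finset.mul_sum]
    refine Finset.sum_congr rfl fun k _ => ?_
    rw [one_pow, map_natCast, pow_add]
    ring
  rw [Sq, aeval_monomial, Finsupp.prod_fintype _ _ fun _ => pow_zero _]
  simp_rw [hfactor]
  rw [algebraMap_eq, coeff_C_mul, Finset.prod_univ_sum, coeff_sum]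
  refine mul_eq_zero_of_right _ (Finset.sum_eq_zero fun k _ => ?_)
  rw [Finset.prod_mul_distrib, ← map_prod, coeff_C_mul]
  by_cases hk : ∀ i, d i + k i = s i
  · obtain ⟨i, hi⟩ : ∃ i, d i ≠ s i := by
      by_contra! h
      exact hd (Finsupp.ext h)
    obtain ⟨m, hm⟩ := hs i
    have heven : Even ((d i).choose (k i)) :=
      even_choose_of_add_add_one_eq_two_pow (m := m) (by rw [hk, hm]) fun h0 => hi (by
        simpa [h0] using hk i)
    exact mul_eq_zero_of_left
      (Finset.prod_eq_zero (Finset.mem_univ i) ((ZMod.natCast_eq_zero_iff_even).2 heven)) _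
  · have hmon : (∏ i, X i ^ (d i + k i) : P5) =
        monomial (Finsupp.equivFunOnFinite.symm fun i => d i + k i) 1 := by
      rw [monomial_eq, Finsupp.prod_fintype _ _ fun _ => pow_zero _]
      simp
    rw [hmon, coeff_monomial, if_neg, mul_zero]
    rintro rfl
    exact hk fun _ => rfl

/-- A hit polynomial has no spikes. -/
lemma IsHit.coeff_spike_eq_zero {n : ℕ} {f : P5} (h : IsHit n f) {s : Fin 5 →₀ ℕ}
    (hs : ∀ i, ∃ m, s i + 1 = 2 ^ m) (hn : s.degree = n) : coeff s f = 0 := by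
  obtain ⟨g, hg, rfl⟩ := h
  rw [coeff_homogeneousComponent, if_pos hn, g.as_sum, map_sum, coeff_sum]
  refine Finset.sum_eq_zero fun d hd => coeff_Sq_monomial_of_spike hs ?_ _
  rintro rfl
  have h0 := congrArg (coeff d) (hg n le_rfl)
  rw [coeff_homogeneousComponent, if_pos hn, coeff_zero] at h0
  exact mem_support_iff.1 hd h0

lemma homogeneousComponent_rename {σ τ R : Type*} [CommSemiring R] (e : σ → τ) (n : ℕ)
    (p : MvPolynomial σ R) :
    homogeneousComponent n (rename e p) = rename e (homogeneousComponent n p) := by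
  induction p using MvPolynomial.induction_on' with
  | monomial d a =>
    have hd := isHomogeneous_monomial (d := d) a rfl
    have hd' := hd.rename_isHomogeneous (f := e)
    rw [homogeneousComponent_of_mem hd, homogeneousComponent_of_mem hd']
    split_ifs <;> simp
  | add p q hp hq => simp only [map_add, hp, hq]

lemma Sq_rename (e : Fin 5 → Fin 5) (p : P5) : Sq (rename e p) = rename e (Sq p) := by
  induction p using MvPolynomial.induction_on with
  | C a => simp [Sq]
  | add p q hp hq => simp only [map_add, hp, hq]
  | mul_X p i hp => rw [map_mul, map_mul, hp, map_mul, map_mul]; simp [Sq]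

lemma IsHit.rename {n : ℕ} {f : P5} (h : IsHit n f) (e : Fin 5 → Fin 5) :
    IsHit n (rename e f) := by
  obtain ⟨g, hg, rfl⟩ := h
  refine ⟨MvPolynomial.rename e g, fun m hm => ?_, ?_⟩
  · rw [homogeneousComponent_rename, hg m hm, map_zero]
  · rw [Sq_rename, homogeneousComponent_rename]

lemma coeff_rename_mon (e : Fin 5 → Fin 5) (s : Fin 5 → ℕ) (a b c d f : ℕ) :
    coeff (Finsupp.equivFunOnFinite.symm s) (rename e (mon a b c d f)) =
      if ∀ i, (∑ j, if e j = i then ![a, b, c, d, f] j else 0) = s i then 1 else 0 := by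
  have hmon : mon a b c d f = monomial (Finsupp.equivFunOnFinite.symm ![a, b, c, d, f]) 1 := by
    rw [monomial_eq, Finsupp.prod_fintype _ _ fun _ => pow_zero _]
    simp [mon, Fin.prod_univ_five]
  rw [hmon, rename_monomial, coeff_monomial]
  congr 1
  rw [Finsupp.ext_iff, Finsupp.mapDomain, Finsupp.sum_fintype _ _ fun _ => Finsupp.single_zero _]
  simp [Finsupp.finsetSum_apply, Finsupp.single_apply]

/-- A hit combination of monomials with exponents `T i` yields a linear relation between its
coefficients for every spike and every substitution of variables by variables. -/
lemma IsHit.sum_filter_eq_zero {ι : Type*} [Fintype ι] {n : ℕ} {c : ι → ZMod 2}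
    {T : ι → Fin 5 → ℕ}
    (h : IsHit n (∑ i, c i • mon (T i 0) (T i 1) (T i 2) (T i 3) (T i 4)))
    {s : Fin 5 → ℕ} (hs : ∀ i, ∃ m, s i + 1 = 2 ^ m) (hn : ∑ i, s i = n) (e : Fin 5 → Fin 5) :
    ∑ i with ∀ k, (∑ j, if e j = k then T i j else 0) = s k, c i = 0 := by
  have hcoeff := (h.rename e).coeff_spike_eq_zero (s := Finsupp.equivFunOnFinite.symm s) hs
    (by rw [Finsupp.degree_eq_sum]; exact hn)
  have hT (i : ι) : ![T i 0, T i 1, T i 2, T i 3, T i 4] = T i := by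
    ext j
    fin_cases j <;> rfl
  simpa only [map_sum, map_smul, coeff_sum, coeff_smul, coeff_rename_mon, hT, smul_eq_mul, mul_ite,
    mul_one, mul_zero, ← Finset.sum_filter] using hcoeff

/-- The classes of the fifteen listed monomials are linearly independent in `(QP_5)_9`. -/
theorem stmt11 (c : Fin 15 → ZMod 2)
    (h : IsHit 9 (∑ i, c i •
      ![mon 1 1 2 2 3, mon 1 1 2 3 2, mon 1 1 3 2 2,
        mon 1 2 1 2 3, mon 1 2 1 3 2, mon 1 2 2 1 3,
        mon 1 2 2 3 1, mon 1 2 3 1 2, mon 1 2 3 2 1,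
        mon 1 3 1 2 2, mon 1 3 2 1 2, mon 1 3 2 2 1,
        mon 3 1 1 2 2, mon 3 1 2 1 2, mon 3 1 2 2 1] i)) :
    ∀ i, c i = 0 := by
  let T : Fin 15 → Fin 5 → ℕ :=
    ![![1, 1, 2, 2, 3], ![1, 1, 2, 3, 2], ![1, 1, 3, 2, 2],
      ![1, 2, 1, 2, 3], ![1, 2, 1, 3, 2], ![1, 2, 2, 1, 3],
      ![1, 2, 2, 3, 1], ![1, 2, 3, 1, 2], ![1, 2, 3, 2, 1],
      ![1, 3, 1, 2, 2], ![1, 3, 2, 1, 2], ![1, 3, 2, 2, 1],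
      ![3, 1, 1, 2, 2], ![3, 1, 2, 1, 2], ![3, 1, 2, 2, 1]]
  have hT : IsHit 9 (∑ i, c i • mon (T i 0) (T i 1) (T i 2) (T i 3) (T i 4)) := by
    convert h using 4 with i
    fin_cases i <;> rfl
  have key {s : Fin 5 → ℕ} (hs : ∀ i, ∃ m, s i + 1 = 2 ^ m) (hn : ∑ i, s i = 9)
      (S : Finset (Fin 15)) (e : Fin 5 → Fin 5)
      (hS : Finset.univ.filter (fun i => ∀ k, (∑ j, if e j = k then T i j else 0) = s k) = S) :
      ∑ i ∈ S, c i = 0 :=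
    hS ▸ hT.sum_filter_eq_zero hs hn e
  have key7 := key (s := ![7, 1, 1, 0, 0]) (fun i => by
    fin_cases i
    exacts [⟨3, rfl⟩, ⟨1, rfl⟩, ⟨1, rfl⟩, ⟨0, rfl⟩, ⟨0, rfl⟩]) rfl
  have key3 := key (s := ![3, 3, 3, 0, 0]) (fun i => by
    fin_cases i
    exacts [⟨2, rfl⟩, ⟨2, rfl⟩, ⟨2, rfl⟩, ⟨0, rfl⟩, ⟨0, rfl⟩]) rfl
  have h12 := key7 {12} ![0, 2, 1, 0, 0] (by decide +kernel)
  have h13 := key7 {13} ![0, 2, 0, 1, 0] (by decide +kernel)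
  have h14 := key7 {14} ![0, 2, 0, 0, 1] (by decide +kernel)
  have h0_1_2 := key7 {0, 1, 2} ![2, 1, 0, 0, 0] (by decide +kernel)
  have h3_4_9 := key7 {3, 4, 9} ![2, 0, 1, 0, 0] (by decide +kernel)
  have h5_7_10 := key7 {5, 7, 10} ![2, 0, 0, 1, 0] (by decide +kernel)
  have h6_8_11 := key7 {6, 8, 11} ![2, 0, 0, 0, 1] (by decide +kernel)
  have h3_5 := key3 {3, 5} ![2, 2, 1, 1, 0] (by decide +kernel)
  have h0_5 := key3 {0, 5} ![2, 1, 2, 1, 0] (by decide +kernel)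
  have h4_6 := key3 {4, 6} ![2, 2, 1, 0, 1] (by decide +kernel)
  have h1_6 := key3 {1, 6} ![2, 1, 2, 0, 1] (by decide +kernel)
  have h7_8 := key3 {7, 8} ![2, 2, 1, 0, 0] (by decide +kernel)
  have h10_11 := key3 {10, 11} ![2, 1, 2, 0, 0] (by decide +kernel)
  have h2_8 := key3 {2, 8} ![2, 1, 0, 2, 1] (by decide +kernel)
  have h9_11 := key3 {9, 11} ![2, 1, 0, 2, 0] (by decide +kernel)
  simp at h12 h13 h14 h0_1_2 h3_4_9 h5_7_10 h6_8_11 h3_5 h0_5 h4_6 h1_6 h7_8 h10_11 h2_8 h9_11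
  intro i
  clear key key7 key3 hT h T
  fin_cases i <;> simp only [Fin.reduceFinMk] <;> grind
end
end

section
/- The classes in (QP_5)_10 of the five monomials x_1x_2x_3^2x_4^2x_5^4, x_1x_2x_3^2x_4^4x_5^2, x_1x_2^2x_3x_4^2x_5^4, x_1x_2^2x_3x_4^4x_5^2, x_1x_2^2x_3^4x_4x_5^2 are linearly independent over F_2; that is, no nonzero F_2-linear combination of these five monomials is hit. -/
open MvPolynomial

noncomputable section

section SpikeFunctionals

/-- The total Steenrod square on `F_2[x_i : i ∈ σ]`. -/
def totalSq (σ : Type*) : MvPolynomial σ (ZMod 2) →ₐ[ZMod 2] MvPolynomial σ (ZMod 2) :=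
  aeval fun i => X i + X i ^ 2

/-- The polynomial algebra `F_2[y, z]`, with `y = X 0` and `z = X 1`. -/
abbrev P2 : Type := MvPolynomial (Fin 2) (ZMod 2)

/-- The linear form `a y + b z`. -/
def linForm (a b : ZMod 2) : P2 := C a * X 0 + C b * X 1

/-- The linear substitution `x_i ↦ a_i y + b_i z`. -/
def linSubst (a b : Fin 5 → ZMod 2) : P5 →ₐ[ZMod 2] P2 := aeval fun i => linForm (a i) (b i)

/-- The exponent vector of `y ^ i z ^ j`. -/
def expVec (i j : ℕ) : Fin 2 →₀ ℕ := Finsupp.single 0 i + Finsupp.single 1 j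

lemma expVec_inj {i j k l : ℕ} : expVec i j = expVec k l ↔ i = k ∧ j = l := by
  refine ⟨fun h => ⟨?_, ?_⟩, fun ⟨h, h'⟩ => h ▸ h' ▸ rfl⟩
  · simpa [expVec] using DFunLike.congr_fun h 0
  · simpa [expVec] using DFunLike.congr_fun h 1

lemma C_mul_X_pow_mul_X_pow (r : ZMod 2) (i j : ℕ) :
    (C r * (X 0 ^ i * X 1 ^ j) : P2) = monomial (expVec i j) r := by
  simp [X_pow_eq_monomial, monomial_mul, C_mul_monomial, expVec]

lemma linForm_isHomogeneous (a b : ZMod 2) : (linForm a b).IsHomogeneous 1 :=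
  ((isHomogeneous_X _ _).C_mul a).add ((isHomogeneous_X _ _).C_mul b)

lemma totalSq_linForm (a b : ZMod 2) :
    totalSq (Fin 2) (linForm a b) = linForm a b + linForm a b ^ 2 := by
  have hsq : ∀ r : ZMod 2, r ^ 2 = r := by decide
  have hC : ∀ r : ZMod 2, (C r ^ 2 : P2) = C r := fun r => by rw [← C_pow, hsq]
  have hX : ∀ i, totalSq (Fin 2) (X i) = X i + X i ^ 2 := fun i => by simp [totalSq]
  have hc : ∀ r : ZMod 2, totalSq (Fin 2) (C r) = C r := fun r => by
    simp [totalSq, algebraMap_eq]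
  simp only [linForm, map_add, map_mul, hX, hc, CharTwo.add_sq, mul_pow, hC]
  ring

lemma linSubst_Sq (a b : Fin 5 → ZMod 2) (f : P5) :
    linSubst a b (Sq f) = totalSq (Fin 2) (linSubst a b f) := by
  have : (linSubst a b).comp Sq = (totalSq (Fin 2)).comp (linSubst a b) := by
    ext1 i
    simp [linSubst, Sq, totalSq_linForm]
  exact DFunLike.congr_fun this f

lemma homogeneousComponent_linSubst (a b : Fin 5 → ZMod 2) (n : ℕ) (f : P5) :
    homogeneousComponent n (linSubst a b f) = linSubst a b (homogeneousComponent n f) := by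
  have hom : ∀ i, (linSubst a b (homogeneousComponent i f)).IsHomogeneous i := fun i => by
    have := (homogeneousComponent_isHomogeneous i f).aeval
      (fun j => linForm (a j) (b j)) (fun j => linForm_isHomogeneous (a j) (b j))
    rwa [one_mul] at this
  conv_lhs => rw [← sum_homogeneousComponent f]
  simp only [map_sum, homogeneousComponent_of_mem (hom _)]
  rw [Finset.sum_ite_eq]
  split_ifs with h
  · rfl
  · rw [homogeneousComponent_eq_zero n f (by simpa using h), map_zero]

/-- The spike `y ^ 7 z ^ 3` does not occur in `Sq` of any other monomial. -/
lemma coeff_totalSq_monomial (i j : ℕ) (h : i + j < 10) :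
    coeff (expVec 7 3) (totalSq (Fin 2) (X 0 ^ i * X 1 ^ j)) = 0 := by
  have expand : ∀ (k : Fin 2) (n : ℕ), ((X k + X k ^ 2) ^ n : P2) =
      ∑ s ∈ Finset.range (n + 1), C ((n.choose s : ℕ) : ZMod 2) * X k ^ (n + s) := fun k n => by
    rw [add_comm, add_pow]
    refine Finset.sum_congr rfl fun s hs => ?_
    have : n + s = 2 * s + (n - s) := by
      have := Finset.mem_range.mp hs
      omega
    rw [this, pow_add, pow_mul, map_natCast]
    ring
  simp only [totalSq, map_mul, map_pow, aeval_X, expand, Finset.sum_mul_sum, coeff_sum]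
  refine Finset.sum_eq_zero fun s _ => Finset.sum_eq_zero fun t _ => ?_
  rw [mul_mul_mul_comm, ← C_mul, C_mul_X_pow_mul_X_pow, coeff_monomial, ite_eq_right_iff,
    expVec_inj]
  rintro ⟨hs, ht⟩
  obtain rfl : s = 7 - i := by omega
  obtain rfl : t = 3 - j := by omega
  have hi : i ≤ 7 := by omega
  have hj : j ≤ 3 := by omega
  revert h
  clear * - hi hj
  interval_cases i <;> interval_cases j <;> decide

lemma coeff_totalSq_of_degree_lt (g : P2) (hg : ∀ n, 10 ≤ n → homogeneousComponent n g = 0) :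
    coeff (expVec 7 3) (totalSq (Fin 2) g) = 0 := by
  rw [g.as_sum, map_sum, coeff_sum]
  refine Finset.sum_eq_zero fun d hd => ?_
  have hdeg : d 0 + d 1 < 10 := by
    by_contra! hle
    refine mem_support_iff.mp hd ?_
    have hdeg : d.degree = d 0 + d 1 := by simp [Finsupp.degree_eq_sum]
    simpa [coeff_homogeneousComponent] using congrArg (coeff d) (hg d.degree (hdeg ▸ hle))
  have hd' : d = expVec (d 0) (d 1) := by
    ext k
    fin_cases k <;> simp [expVec]
  have hmon : (monomial d (coeff d g) : P2) = coeff d g • (X 0 ^ d 0 * X 1 ^ d 1) := by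
    rw [smul_eq_C_mul, C_mul_X_pow_mul_X_pow, ← hd']
  rw [hmon, map_smul, coeff_smul, coeff_totalSq_monomial _ _ hdeg, smul_zero]

/-- Every linear substitution followed by reading the coefficient of the spike `y ^ 7 z ^ 3`
vanishes on hit polynomials. -/
lemma IsHit.coeff_linSubst_eq_zero {f : P5} (hf : IsHit 10 f) (a b : Fin 5 → ZMod 2) :
    coeff (expVec 7 3) (linSubst a b f) = 0 := by
  obtain ⟨g, hg, rfl⟩ := hf
  have hdeg : (expVec 7 3).degree = 10 := by simp [expVec, Finsupp.degree_eq_sum]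
  rw [← homogeneousComponent_linSubst, coeff_homogeneousComponent, if_pos hdeg, linSubst_Sq]
  refine coeff_totalSq_of_degree_lt _ fun n hn => ?_
  rw [homogeneousComponent_linSubst, hg n hn, map_zero]

lemma coeff_prod_linForm (a₁ b₁ a₂ b₂ a₃ b₃ a₄ b₄ a₅ b₅ : ZMod 2) :
    coeff (expVec 7 3) (linForm a₁ b₁ * linForm a₂ b₂ * linForm a₃ b₃ ^ 2 * linForm a₄ b₄ ^ 2 *
      linForm a₅ b₅ ^ 4) = (a₁ * b₂ + a₂ * b₁) * (a₃ * b₄ + a₄ * b₃) * a₅ := by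
  have hsq : ∀ r : ZMod 2, r ^ 2 = r := by decide
  have hC : ∀ r : ZMod 2, (C r ^ 2 : P2) = C r := fun r => by rw [← C_pow, hsq]
  have two : ∀ a b, linForm a b ^ 2 = C a * X 0 ^ 2 + C b * X 1 ^ 2 := fun a b => by
    rw [linForm, CharTwo.add_sq, mul_pow, mul_pow, hC, hC]
  have four : linForm a₅ b₅ ^ 4 = C a₅ * X 0 ^ 4 + C b₅ * X 1 ^ 4 := by
    rw [show (4 : ℕ) = 2 * 2 from rfl, pow_mul, two, CharTwo.add_sq, mul_pow, mul_pow, hC, hC,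
      ← pow_mul, ← pow_mul]
  have expand : linForm a₁ b₁ * linForm a₂ b₂ * linForm a₃ b₃ ^ 2 * linForm a₄ b₄ ^ 2 *
      linForm a₅ b₅ ^ 4 =
      (C (a₁ * a₂) * (X 0 ^ 2 * X 1 ^ 0) + C (a₁ * b₂ + a₂ * b₁) * (X 0 ^ 1 * X 1 ^ 1) +
        C (b₁ * b₂) * (X 0 ^ 0 * X 1 ^ 2)) *
      (C (a₃ * a₄) * (X 0 ^ 4 * X 1 ^ 0) + C (a₃ * b₄ + a₄ * b₃) * (X 0 ^ 2 * X 1 ^ 2) +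
        C (b₃ * b₄) * (X 0 ^ 0 * X 1 ^ 4)) *
      (C a₅ * (X 0 ^ 4 * X 1 ^ 0) + C b₅ * (X 0 ^ 0 * X 1 ^ 4)) := by
    rw [two, two, four]
    simp only [linForm, C_add, C_mul]
    ring
  have add_expVec : ∀ i j k l, expVec i j + expVec k l = expVec (i + k) (j + l) := by
    intro i j k l
    simp only [expVec, Finsupp.single_add]
    abel
  rw [expand]
  simp only [C_mul_X_pow_mul_X_pow, add_mul, mul_add, monomial_mul, add_expVec, coeff_add,
    coeff_monomial, expVec_inj]
  norm_num

end SpikeFunctionals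

/-- The classes of the five listed monomials are linearly independent in `(QP_5)_10`. -/
theorem stmt12 (c : Fin 5 → ZMod 2)
    (h : IsHit 10 (∑ i, c i •
      ![mon 1 1 2 2 4, mon 1 1 2 4 2, mon 1 2 1 2 4,
        mon 1 2 1 4 2, mon 1 2 4 1 2] i)) :
    ∀ i, c i = 0 := by
  have key : ∀ a b : Fin 5 → ZMod 2,
      c 0 * ((a 0 * b 1 + a 1 * b 0) * (a 2 * b 3 + a 3 * b 2) * a 4) +
      c 1 * ((a 0 * b 1 + a 1 * b 0) * (a 2 * b 4 + a 4 * b 2) * a 3) +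
      c 2 * ((a 0 * b 2 + a 2 * b 0) * (a 1 * b 3 + a 3 * b 1) * a 4) +
      c 3 * ((a 0 * b 2 + a 2 * b 0) * (a 1 * b 4 + a 4 * b 1) * a 3) +
      c 4 * ((a 0 * b 3 + a 3 * b 0) * (a 1 * b 4 + a 4 * b 1) * a 2) = 0 := by
    intro a b
    rw [← h.coeff_linSubst_eq_zero a b]
    simp only [Fin.sum_univ_five, map_add, map_smul, coeff_add, coeff_smul, smul_eq_mul, mon,
      linSubst, map_mul, map_pow, aeval_X, Matrix.cons_val, pow_one]
    have e i j k l m :=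
      coeff_prod_linForm (a i) (b i) (a j) (b j) (a k) (b k) (a l) (b l) (a m) (b m)
    rw [← e 0 1 2 3 4, ← e 0 1 2 4 3, ← e 0 2 1 3 4, ← e 0 2 1 4 3, ← e 0 3 1 4 2]
    ring_nf
  intro i
  fin_cases i
  · simpa [CharTwo.add_self_eq_zero] using key ![1, 1, 1, 0, 1] ![0, 1, 0, 1, 1]
  · simpa [CharTwo.add_self_eq_zero] using key ![1, 0, 1, 1, 0] ![0, 1, 0, 0, 1]
  · simpa [CharTwo.add_self_eq_zero] using key ![1, 1, 0, 0, 1] ![0, 0, 1, 1, 0]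
  · simpa [CharTwo.add_self_eq_zero] using key ![1, 1, 0, 1, 0] ![0, 0, 1, 0, 1]
  · simpa [CharTwo.add_self_eq_zero] using key ![1, 1, 1, 0, 0] ![0, 0, 0, 1, 1]
end
end

section
/- For every monomial x of degree 23 in P_5 with weight vector ω(x) = (3,2,4,0,0,...), there exist a hit polynomial h and a polynomial p lying in the F_2-span of monomials of degree 23 whose weight vector is strictly smaller than (3,2,4,0,0,...) in left lexicographic order, such that x = h + p. Equivalently, QP_5((3,2,4)) = 0. -/
open MvPolynomial

noncomputable section

/-- The number of entries of `v` whose bit `i` is `1`. -/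
def bitCount (v : Fin 5 → ℕ) (i : ℕ) : ℕ := ∑ j, ((v j).testBit i).toNat

/-- The exponent vector `v` has weight vector `(3, 2, 4)`. -/
def HasTopWeight (v : Fin 5 → ℕ) : Prop :=
  (∀ j, v j < 8) ∧ bitCount v 0 = 3 ∧ bitCount v 1 = 2 ∧ bitCount v 2 = 4

/-- The first three weights of `v` are lexicographically smaller than `(3, 2, 4)`. -/
def HasLowerWeight (v : Fin 5 → ℕ) : Prop :=
  bitCount v 0 < 3 ∨ bitCount v 0 = 3 ∧ (bitCount v 1 < 2 ∨ bitCount v 1 = 2 ∧ bitCount v 2 < 4)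

instance : DecidablePred HasTopWeight := fun v => by unfold HasTopWeight; infer_instance
instance : DecidablePred HasLowerWeight := fun v => by unfold HasLowerWeight; infer_instance

/-- The order in which monomials of weight `(3, 2, 4)` are eliminated. -/
def eliminationRank (v : Fin 5 → ℕ) : ℕ :=
  if ∃ j, v j = 3 then 2 else if ∃ j, v j = 2 then 1 else 0

/-- `u` has smaller weight than `(3, 2, 4)`, or is eliminated before `v`. -/
def Precedes (u v : Fin 5 → ℕ) : Prop :=
  HasLowerWeight u ∨ HasTopWeight u ∧ eliminationRank u < eliminationRank v

instance (u v : Fin 5 → ℕ) : Decidable (Precedes u v) := by unfold Precedes; infer_instance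

/-- The coefficient of `x ^ (g + k)` in the total square of `x ^ g`. -/
def sqCoeff (g k : Fin 5 → ℕ) : ℕ := ∏ i, (g i).choose (k i)

/-- Apart from `x ^ v`, the monomials of `Sq¹ (x ^ (v - e_i))` all precede `x ^ v`. -/
def ReducesBySq1 (v : Fin 5 → ℕ) (i : Fin 5) : Prop :=
  v i = 2 ∧ ∀ j, j ≠ i →
      sqCoeff (v - Pi.single i 1) (Pi.single j 1) % 2 = 1 →
      Precedes (v - Pi.single i 1 + Pi.single j 1) v

/-- Apart from `x ^ v`, the monomials of `Sq² (x ^ (v - 2 e_i))` all precede `x ^ v`. -/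
def ReducesBySq2 (v : Fin 5 → ℕ) (i : Fin 5) : Prop :=
  (v i = 4 ∨ v i = 5) ∧ ∀ j l, j ≤ l → (j ≠ i ∨ l ≠ i) →
      sqCoeff (v - Pi.single i 2) (Pi.single j 1 + Pi.single l 1) % 2 = 1 →
      Precedes (v - Pi.single i 2 + (Pi.single j 1 + Pi.single l 1)) v

instance (v : Fin 5 → ℕ) (i : Fin 5) : Decidable (ReducesBySq1 v i) := by
  unfold ReducesBySq1; infer_instance

instance (v : Fin 5 → ℕ) (i : Fin 5) : Decidable (ReducesBySq2 v i) := by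
  unfold ReducesBySq2; infer_instance

theorem exists_reduction_of_entries : ∀ a b c d : Fin 8,
    HasTopWeight ![(a : ℕ), b, c, d, 23 - (a + b + c + d)] → ∃ i,
    ReducesBySq1 ![(a : ℕ), b, c, d, 23 - (a + b + c + d)] i ∨
    ReducesBySq2 ![(a : ℕ), b, c, d, 23 - (a + b + c + d)] i := by
  decide +kernel

theorem HasTopWeight.exists_reduction {v : Fin 5 → ℕ} (hv : HasTopWeight v)
    (hs : ∑ j, v j = 23) : ∃ i, ReducesBySq1 v i ∨ ReducesBySq2 v i := by
  have h := exists_reduction_of_entries ⟨v 0, hv.1 0⟩ ⟨v 1, hv.1 1⟩ ⟨v 2, hv.1 2⟩ ⟨v 3, hv.1 3⟩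
  have e : ![v 0, v 1, v 2, v 3, 23 - (v 0 + v 1 + v 2 + v 3)] = v := by
    rw [Fin.sum_univ_five] at hs
    funext j
    fin_cases j <;> simp
    omega
  simp only [e] at h
  exact h hv

/-- The monomial with exponent vector `v`. -/
def xpow (v : Fin 5 → ℕ) : P5 := ∏ i, X i ^ v i

theorem xpow_eq_monomial (d : Fin 5 →₀ ℕ) : xpow d = monomial d 1 := by
  simp [xpow, monomial_eq, Finsupp.prod_fintype]

theorem xpow_isHomogeneous (v : Fin 5 → ℕ) : (xpow v).IsHomogeneous (∑ i, v i) :=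
  IsHomogeneous.prod _ _ _ fun i _ => isHomogeneous_X_pow i (v i)

theorem Sq_xpow (g : Fin 5 → ℕ) :
    Sq (xpow g) = ∑ k ∈ Fintype.piFinset fun i => Finset.range (g i + 1),
      (sqCoeff g k : ZMod 2) • xpow (g + k) := by
  have h (i : Fin 5) : (Sq (X i ^ g i) : P5) =
      ∑ k ∈ Finset.range (g i + 1), ((g i).choose k : P5) * X i ^ (g i + k) := by
    rw [map_pow, Sq, aeval_X, show (X i + X i ^ 2 : P5) = X i * (X i + 1) by ring, mul_pow,
      add_pow, Finset.mul_sum]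
    refine Finset.sum_congr rfl fun k _ => ?_
    rw [one_pow, pow_add]
    ring
  rw [xpow, map_prod, Finset.prod_congr rfl fun i _ => h i, Finset.prod_univ_sum]
  refine Finset.sum_congr rfl fun k _ => ?_
  rw [Finset.prod_mul_distrib, xpow, sqCoeff, smul_eq_C_mul]
  simp

theorem homogeneousComponent_Sq_xpow (g : Fin 5 → ℕ) (m : ℕ) :
    homogeneousComponent (∑ i, g i + m) (Sq (xpow g)) =
      ∑ k ∈ Fintype.piFinset fun i => Finset.range (g i + 1),
        if ∑ i, k i = m then (sqCoeff g k : ZMod 2) • xpow (g + k) else 0 := by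
  rw [Sq_xpow, map_sum]
  refine Finset.sum_congr rfl fun k _ => ?_
  rw [map_smul, homogeneousComponent_of_mem (xpow_isHomogeneous (g + k))]
  simp only [Pi.add_apply, Finset.sum_add_distrib, add_right_inj, smul_ite, smul_zero, eq_comm]

/-- The polynomials that are hit in degree `n`. -/
def hits (n : ℕ) : Submodule (ZMod 2) P5 where
  carrier := {f | IsHit n f}
  zero_mem' := ⟨0, by simp, by simp⟩
  add_mem' := by
    rintro _ _ ⟨g, hg, rfl⟩ ⟨g', hg', rfl⟩
    exact ⟨g + g', fun m hm => by rw [map_add, hg m hm, hg' m hm, add_zero], by simp⟩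
  smul_mem' := by
    rintro c _ ⟨g, hg, rfl⟩
    exact ⟨c • g, fun m hm => by rw [map_smul, hg m hm, smul_zero], by simp⟩

theorem homogeneousComponent_Sq_xpow_mem_hits (g : Fin 5 → ℕ) {m : ℕ} (hm : 0 < m) :
    homogeneousComponent (∑ i, g i + m) (Sq (xpow g)) ∈ hits (∑ i, g i + m) := by
  refine ⟨xpow g, fun l hl => ?_, rfl⟩
  rw [homogeneousComponent_of_mem (xpow_isHomogeneous g), if_neg (by omega)]

theorem xpow_mem_of_sqCoeff {N : Submodule (ZMod 2) P5} {g k : Fin 5 → ℕ} {m : ℕ} (hm : 0 < m)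
    (hN : hits (∑ i, g i + m) ≤ N) (hk : ∑ i, k i = m) (hodd : sqCoeff g k % 2 = 1)
    (h : ∀ l, ∑ i, l i = m → l ≠ k → sqCoeff g l % 2 = 1 → xpow (g + l) ∈ N) :
    xpow (g + k) ∈ N := by
  have hkm : k ∈ Fintype.piFinset fun i => Finset.range (g i + 1) := by
    rw [Fintype.mem_piFinset]
    intro i
    by_contra hi
    have : sqCoeff g k = 0 := Finset.prod_eq_zero (Finset.mem_univ i)
      (Nat.choose_eq_zero_of_lt (by simpa using hi))
    omega
  have hmem := hN (homogeneousComponent_Sq_xpow_mem_hits g hm)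
  rw [homogeneousComponent_Sq_xpow, ← Finset.add_sum_erase _ _ hkm, if_pos hk,
    (ZMod.natCast_eq_one_iff_odd).2 (Nat.odd_iff.2 hodd), one_smul] at hmem
  refine (Submodule.add_mem_iff_left N (Submodule.sum_mem N fun l hl => ?_)).1 hmem
  split_ifs with hl'
  · rcases Nat.mod_two_eq_zero_or_one (sqCoeff g l) with h0 | h1
    · rw [(ZMod.natCast_eq_zero_iff_even).2 (Nat.even_iff.2 h0), zero_smul]
      exact N.zero_mem
    · exact N.smul_mem _ (h l hl' (Finset.ne_of_mem_erase hl) h1)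
  · exact N.zero_mem

theorem exists_eq_add_single {m : ℕ} {l : Fin 5 → ℕ} (hl : ∑ i, l i = m + 1) :
    ∃ (l' : Fin 5 → ℕ) (j : Fin 5), l = l' + Pi.single j 1 ∧ ∑ i, l' i = m := by
  obtain ⟨j, hj⟩ : ∃ j, l j ≠ 0 := by
    by_contra! h
    simp [h] at hl
  have e : l = (l - Pi.single j 1) + Pi.single j 1 := by
    refine (tsub_add_cancel_of_le fun i => ?_).symm
    obtain rfl | hi := eq_or_ne i j
    · simpa using Nat.one_le_iff_ne_zero.2 hj
    · simp [hi]
  refine ⟨l - Pi.single j 1, j, e, ?_⟩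
  rw [e] at hl
  simp only [Pi.add_apply, Finset.sum_add_distrib, Finset.sum_pi_single', Finset.mem_univ,
    if_true] at hl
  omega

theorem exists_eq_single {l : Fin 5 → ℕ} (hl : ∑ i, l i = 1) : ∃ j, l = Pi.single j 1 := by
  obtain ⟨l', j, rfl, h⟩ := exists_eq_add_single hl
  have : l' = 0 := funext fun i => (Finset.sum_eq_zero_iff.1 h) i (Finset.mem_univ i)
  exact ⟨j, by simp [this]⟩

theorem exists_eq_single_add_single {l : Fin 5 → ℕ} (hl : ∑ i, l i = 2) :
    ∃ a b, a ≤ b ∧ l = Pi.single a 1 + Pi.single b 1 := by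
  obtain ⟨l', a, rfl, hl'⟩ := exists_eq_add_single hl
  obtain ⟨b, rfl⟩ := exists_eq_single hl'
  rcases le_total a b with hab | hab
  · exact ⟨a, b, hab, add_comm _ _⟩
  · exact ⟨b, a, hab, rfl⟩

theorem sum_sub_single_add {v : Fin 5 → ℕ} {i : Fin 5} {m : ℕ} (h : m ≤ v i) :
    v - Pi.single i m + Pi.single i m = v ∧
      ∑ j, (v - Pi.single i m : Fin 5 → ℕ) j + m = ∑ j, v j := by
  have e : v - Pi.single i m + Pi.single i m = v := by
    refine tsub_add_cancel_of_le fun j => ?_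
    obtain rfl | hj := eq_or_ne j i
    · simpa using h
    · simp [hj]
  refine ⟨e, ?_⟩
  conv_rhs => rw [← e]
  simp [Finset.sum_add_distrib]

theorem sqCoeff_single (g : Fin 5 → ℕ) (i : Fin 5) (m : ℕ) :
    sqCoeff g (Pi.single i m) = (g i).choose m := by
  rw [sqCoeff, Finset.prod_eq_single i (fun j _ hj => by simp [hj]) (by simp), Pi.single_eq_same]

theorem ReducesBySq1.xpow_mem {N : Submodule (ZMod 2) P5} {v : Fin 5 → ℕ} {i : Fin 5}
    (h : ReducesBySq1 v i) (hN : hits (∑ j, v j) ≤ N)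
    (hrec : ∀ u, ∑ j, u j = ∑ j, v j → Precedes u v → xpow u ∈ N) : xpow v ∈ N := by
  obtain ⟨hi, h⟩ := h
  obtain ⟨e, hs⟩ := sum_sub_single_add (v := v) (i := i) (m := 1) (by omega)
  rw [← e]
  refine xpow_mem_of_sqCoeff one_pos (hs ▸ hN) (by simp) (by simp [sqCoeff_single, hi]) ?_
  intro l hl hne hodd
  obtain ⟨j, rfl⟩ := exists_eq_single hl
  refine hrec _ ?_ (h j (fun hj => hne (by rw [hj])) hodd)
  rw [← hs]
  simp [Finset.sum_add_distrib]

theorem ReducesBySq2.xpow_mem {N : Submodule (ZMod 2) P5} {v : Fin 5 → ℕ} {i : Fin 5}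
    (h : ReducesBySq2 v i) (hN : hits (∑ j, v j) ≤ N)
    (hrec : ∀ u, ∑ j, u j = ∑ j, v j → Precedes u v → xpow u ∈ N) : xpow v ∈ N := by
  obtain ⟨hi, h⟩ := h
  obtain ⟨e, hs⟩ := sum_sub_single_add (v := v) (i := i) (m := 2) (by omega)
  rw [← e]
  refine xpow_mem_of_sqCoeff two_pos (hs ▸ hN) (by simp) ?_ ?_
  · rcases hi with hi | hi <;> simp [sqCoeff_single, hi]
  intro l hl hne hodd
  obtain ⟨b, a, hab, rfl⟩ := exists_eq_single_add_single hl
  refine hrec _ ?_ (h b a hab ?_ hodd)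
  · rw [← hs, ← hl]
    simp [Finset.sum_add_distrib]
  · by_contra! hi'
    exact hne (by rw [hi'.1, hi'.2, ← Pi.single_add])

theorem wt_eq_bitCount (d : Fin 5 →₀ ℕ) (i : ℕ) : wt d i = bitCount d i := by
  rw [wt, bitCount, Finset.card_filter]
  exact Finset.sum_congr rfl fun j _ => by cases (d j).testBit i <;> rfl

theorem hasTopWeight_of_hasWt {d : Fin 5 →₀ ℕ} (h : hasWt d [3, 2, 4]) : HasTopWeight d := by
  refine ⟨fun j => Nat.lt_pow_two_of_testBit (n := 3) _ fun i hi => ?_, ?_, ?_, ?_⟩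
  · have h0 : wt d i = 0 := by
      rw [h i, List.getD_eq_default _ _ (by simpa using hi)]
    rw [wt, Finset.card_eq_zero, Finset.filter_eq_empty_iff] at h0
    simpa using h0 (Finset.mem_univ j)
  · rw [← wt_eq_bitCount, h]; rfl
  · rw [← wt_eq_bitCount, h]; rfl
  · rw [← wt_eq_bitCount, h]; rfl

theorem HasLowerWeight.wtLt {d : Fin 5 →₀ ℕ} (h : HasLowerWeight d) : wtLt d [3, 2, 4] := by
  simp only [HasLowerWeight, ← wt_eq_bitCount] at h
  rcases h with h | ⟨h0, h | ⟨h1, h⟩⟩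
  · exact ⟨0, by simp, h⟩
  · refine ⟨1, fun j hj => ?_, h⟩
    interval_cases j
    exact h0
  · refine ⟨2, fun j hj => ?_, h⟩
    interval_cases j
    exacts [h0, h1]

theorem HasLowerWeight.xpow_mem_PMinus {v : Fin 5 → ℕ} (h : HasLowerWeight v)
    (hs : ∑ j, v j = 23) : xpow v ∈ PMinus 23 [3, 2, 4] := by
  obtain ⟨d, rfl⟩ := Finsupp.equivFunOnFinite.surjective v
  exact Submodule.subset_span ⟨d, xpow_eq_monomial d, hs, HasLowerWeight.wtLt (d := d) h⟩

theorem HasTopWeight.xpow_mem {v : Fin 5 → ℕ} (hv : HasTopWeight v) (hs : ∑ j, v j = 23) :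
    xpow v ∈ hits 23 ⊔ PMinus 23 [3, 2, 4] := by
  induction hr : eliminationRank v using Nat.strong_induction_on generalizing v with
  | _ r ih =>
    have hN : hits (∑ j, v j) ≤ hits 23 ⊔ PMinus 23 [3, 2, 4] := hs ▸ le_sup_left
    have hrec (u : Fin 5 → ℕ) (hu : ∑ j, u j = ∑ j, v j) (huv : Precedes u v) :
        xpow u ∈ hits 23 ⊔ PMinus 23 [3, 2, 4] := by
      rcases huv with hlow | ⟨htop, hlt⟩
      · exact Submodule.mem_sup_right (hlow.xpow_mem_PMinus (hu.trans hs))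
      · exact ih _ (hr ▸ hlt) htop (hu.trans hs) rfl
    obtain ⟨i, h | h⟩ := hv.exists_reduction hs
    · exact h.xpow_mem hN hrec
    · exact h.xpow_mem hN hrec

/-- `QP_5((3,2,4)) = 0`: every degree-23 monomial of weight vector (3,2,4) is a hit polynomial
plus a combination of degree-23 monomials of strictly smaller weight vector. -/
theorem stmt13 (d : Fin 5 →₀ ℕ) (hd : (∑ j, d j) = 23) (hw : hasWt d [3, 2, 4]) :
    ∃ h p : P5, IsHit 23 h ∧ p ∈ PMinus 23 [3, 2, 4] ∧
      (monomial d 1 : P5) = h + p := by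
  have hmem := (hasTopWeight_of_hasWt hw).xpow_mem hd
  rw [xpow_eq_monomial] at hmem
  obtain ⟨h, hh, p, hp, e⟩ := Submodule.mem_sup.1 hmem
  exact ⟨h, p, hh, hp, e.symm⟩
end
end
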